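/- arXiv:1512.07138 — 4 statements merged into one kernel-verified Lean document; each statement's English description precedes it below -/
import Mathlib

section
/- Assume λ, μ > 0 and R > 0 satisfy ζ(R) < 1/(2λ · max_{i=1,…,m}(|I⁺_i| + |I⁻_i|)‖a‖_{+,i}) and μ > max_{i=1,…,m} 1/(γ(R)‖A_i‖). Then every non-negative solution w of u'' + (λa⁺(t) − μa⁻(t)) g(u) = 0 defined on all of ℝ with sup_{t∈ℝ} w(t) ≤ R satisfies w(t) < R for all t ∈ ℝ. -/
open MeasureTheory Set Filter Topology

/-- A Carathéodory solution of `u'' + q(t) G(u) = 0` on all of `ℝ`: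
`u` is `C¹` with derivative `v`, and `v t = v t₀ - ∫_{t₀}^{t} q s * G (u s) ds`. -/
def IsSolR (q G u v : ℝ → ℝ) : Prop :=
  (∀ t, HasDerivAt u (v t) t) ∧
    ∀ t₀ t : ℝ, v t = v t₀ - ∫ s in t₀..t, q s * G (u s)

/-- A lower bound on the derivative gives a linear lower bound on the increment. -/
lemma sub_le_of_neg_le_deriv {u v : ℝ → ℝ} (hu : ∀ t, HasDerivAt u (v t) t) {x y K : ℝ}
    (hxy : x ≤ y) (hv : ∀ t ∈ Icc x y, -K ≤ v t) : u x - K * (y - x) ≤ u y := by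
  have hmono : MonotoneOn (fun t => u t + K * t) (Icc x y) := by
    have hd : ∀ t, HasDerivAt (fun t => u t + K * t) (v t + K * 1) t := fun t =>
      (hu t).add ((hasDerivAt_id t).const_mul K)
    refine monotoneOn_of_deriv_nonneg (convex_Icc x y)
      (fun t _ => (hd t).continuousAt.continuousWithinAt)
      (fun t _ => (hd t).differentiableAt.differentiableWithinAt) fun t ht => ?_
    rw [(hd t).deriv]
    have := hv t (interior_subset ht)
    linarith
  have := hmono (left_mem_Icc.2 hxy) (right_mem_Icc.2 hxy) hxy
  simp only at this
  linarith

/-- The derivative component of a solution is continuous. -/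
lemma continuous_of_integral_eq {v f : ℝ → ℝ} (hf : ∀ x y, IntervalIntegrable f volume x y)
    (hv : ∀ t₀ t : ℝ, v t = v t₀ - ∫ s in t₀..t, f s) : Continuous v := by
  have : v = fun t => v 0 - ∫ s in (0 : ℝ)..t, f s := funext fun t => hv 0 t
  rw [this]
  exact continuous_const.sub (intervalIntegral.continuous_primitive hf 0)

/-- A solution cannot reach its upper bound `R` with zero slope in an interval `[σ, τ]` of
positivity of the weight which is followed by an interval `[τ, ρ]` where the weight is
sufficiently negative. -/
lemma false_of_max_mem_positivity_interval {p n g w v : ℝ → ℝ} {σ τ ρ t₀ lam mu R Z c : ℝ}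
    (hp : ∀ t, 0 ≤ p t) (hn : ∀ t, 0 ≤ n t)
    (hpi : ∀ x y, IntervalIntegrable p volume x y)
    (hni : ∀ x y, IntervalIntegrable n volume x y)
    (hpτ : ∀ᵐ t : ℝ ∂volume, t ∈ Icc τ ρ → p t = 0)
    (hG : Continuous fun t => g (w t)) (hG0 : ∀ t, 0 ≤ g (w t))
    (hsol : IsSolR (fun t => lam * p t - mu * n t) g w v)
    (hlam : 0 < lam) (hmu : 0 < mu) (hR : 0 < R) (hZ : 0 ≤ Z)
    (hwR : ∀ t, w t ≤ R)
    (hZg : ∀ s ∈ Icc (R / 2) R, g s ≤ Z * R) (hcg : ∀ s ∈ Icc (R / 2) R, c * (R / 2) ≤ g s)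
    (ht₀ : t₀ ∈ Icc σ τ) (hτρ : τ ≤ ρ) (hw₀ : w t₀ = R) (hv₀ : v t₀ = 0)
    (hsmall : lam * Z * (ρ - σ) * (∫ t in σ..τ, p t) < 1 / 2)
    (hlarge : 1 < mu * (c * ∫ t in τ..ρ, ∫ s in τ..t, n s)) : False := by
  obtain ⟨hw, hv⟩ := hsol
  have hwc : Continuous w := continuous_iff_continuousAt.2 fun t => (hw t).continuousAt
  have hqi : ∀ x y, IntervalIntegrable (fun s => (lam * p s - mu * n s) * g (w s)) volume x y :=
    fun x y => (((hpi x y).const_mul lam).sub ((hni x y).const_mul mu)).mul_continuousOn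
      hG.continuousOn
  have hvc : Continuous v := continuous_of_integral_eq hqi hv
  have hpint : ∫ t in σ..ρ, p t = ∫ t in σ..τ, p t := by
    rw [← intervalIntegral.integral_add_adjacent_intervals (hpi σ τ) (hpi τ ρ)]
    have : ∫ t in τ..ρ, p t = 0 := by
      apply intervalIntegral.integral_zero_ae
      filter_upwards [hpτ] with t ht hmem
      rw [uIoc_of_le hτρ] at hmem
      exact ht (Ioc_subset_Icc_self hmem)
    rw [this, add_zero]
  set P := ∫ t in σ..τ, p t
  have hP0 : 0 ≤ P := intervalIntegral.integral_nonneg (ht₀.1.trans ht₀.2) fun t _ => hp t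
  set K := lam * (Z * R) * P with hK
  have hK0 : 0 ≤ K := by positivity
  have hKR : K * (ρ - σ) < R / 2 := by
    have := mul_lt_mul_of_pos_right hsmall hR
    rw [hK]
    linarith
  -- the slope bound, valid as long as the solution has stayed above `R / 2`
  have hslope : ∀ y ≤ ρ, (∀ s ∈ Ico t₀ y, R / 2 ≤ w s) → ∀ t ∈ Icc t₀ y, -K ≤ v t := by
    intro y hy hws t ht
    have hle : ∫ s in t₀..t, (lam * p s - mu * n s) * g (w s) ≤
        ∫ s in t₀..t, lam * (Z * R) * p s := by
      refine intervalIntegral.integral_mono_on_of_le_Ioo ht.1 (hqi _ _) ((hpi _ _).const_mul _)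
        fun s hs => ?_
      have h1 : g (w s) ≤ Z * R := hZg _ ⟨hws s ⟨hs.1.le, hs.2.trans_le ht.2⟩, hwR s⟩
      have h2 := mul_le_mul_of_nonneg_left h1 (mul_nonneg hlam.le (hp s))
      have h3 := mul_nonneg (mul_nonneg hmu.le (hn s)) (hG0 s)
      linarith
    have hle' : ∫ s in t₀..t, p s ≤ P := by
      rw [← hpint]
      exact intervalIntegral.integral_mono_interval ht₀.1 ht.1 (ht.2.trans hy)
        (ae_of_all _ hp) (hpi _ _)
    rw [intervalIntegral.integral_const_mul] at hle
    have h4 : lam * (Z * R) * (∫ s in t₀..t, p s) ≤ K :=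
      mul_le_mul_of_nonneg_left hle' (by positivity)
    have := hv t₀ t
    linarith
  have habove : ∀ t ∈ Icc t₀ ρ, R / 2 < w t := by
    by_contra! hcon
    obtain ⟨b, hb, hbw⟩ := hcon
    have hcomp : IsCompact (Icc t₀ ρ ∩ {t | w t ≤ R / 2}) :=
      isCompact_Icc.inter_right (isClosed_le hwc continuous_const)
    obtain ⟨y, hy, hmin⟩ := hcomp.exists_isLeast ⟨b, hb, hbw⟩
    have hws : ∀ s ∈ Ico t₀ y, R / 2 ≤ w s := by
      intro s hs
      by_contra! hlt
      exact absurd (hmin ⟨⟨hs.1, hs.2.le.trans hy.1.2⟩, hlt.le⟩) (not_le.2 hs.2)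
    have h1 := sub_le_of_neg_le_deriv hw hy.1.1 (hslope y hy.1.2 hws)
    have h2 : K * (y - t₀) ≤ K * (ρ - σ) :=
      mul_le_mul_of_nonneg_left (by linarith [hy.1.2, ht₀.1]) hK0
    have h3 : w y ≤ R / 2 := hy.2
    linarith
  have hvK := hslope ρ le_rfl fun s hs => (habove s ⟨hs.1, hs.2.le⟩).le
  have hwτ := sub_le_of_neg_le_deriv hw ht₀.2 fun t ht => hvK t ⟨ht.1, ht.2.trans hτρ⟩
  have hvlow : ∀ t ∈ Icc τ ρ, -K + mu * (c * (R / 2)) * (∫ s in τ..t, n s) ≤ v t := by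
    intro t ht
    have hle : ∫ s in τ..t, (lam * p s - mu * n s) * g (w s) ≤
        ∫ s in τ..t, -(mu * (c * (R / 2))) * n s := by
      refine intervalIntegral.integral_mono_ae_restrict ht.1 (hqi _ _) ((hni _ _).const_mul _) ?_
      filter_upwards [ae_restrict_of_ae hpτ, ae_restrict_mem measurableSet_Icc] with s hs hmem
      have hmem' : s ∈ Icc τ ρ := ⟨hmem.1, hmem.2.trans ht.2⟩
      have h1 : c * (R / 2) ≤ g (w s) :=
        hcg _ ⟨(habove s ⟨ht₀.2.trans hmem.1, hmem'.2⟩).le, hwR s⟩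
      have h2 := mul_le_mul_of_nonneg_left h1 (mul_nonneg hmu.le (hn s))
      rw [hs hmem']
      linarith
    rw [intervalIntegral.integral_const_mul] at hle
    have h1 := hv τ t
    have h2 := hvK τ ⟨ht₀.2, hτρ⟩
    linarith
  have hAc : Continuous fun t => ∫ s in τ..t, n s := intervalIntegral.continuous_primitive hni τ
  have hftc : ∫ t in τ..ρ, v t = w ρ - w τ :=
    intervalIntegral.integral_eq_sub_of_hasDerivAt (fun t _ => hw t) (hvc.intervalIntegrable _ _)
  have hint : ∫ t in τ..ρ, (-K + mu * (c * (R / 2)) * ∫ s in τ..t, n s) ≤ ∫ t in τ..ρ, v t :=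
    intervalIntegral.integral_mono_on hτρ
      ((continuous_const.add (continuous_const.mul hAc)).intervalIntegrable _ _)
      (hvc.intervalIntegrable _ _) hvlow
  rw [intervalIntegral.integral_add (continuous_const.intervalIntegrable _ _)
      ((hAc.intervalIntegrable _ _).const_mul _), intervalIntegral.integral_const,
    intervalIntegral.integral_const_mul, hftc, smul_eq_mul] at hint
  have h1 := mul_lt_mul_of_pos_right hlarge (half_pos hR)
  have h2 : K * (ρ - t₀) ≤ K * (ρ - σ) :=
    mul_le_mul_of_nonneg_left (by linarith [ht₀.1]) hK0
  have h3 := hwR ρ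
  linarith

/-- A maximum `R` reached in an interval where the weight is non-positive propagates to the right
end of that interval. -/
lemma le_right_of_max_mem_negativity_interval {q g w v : ℝ → ℝ} {τ ρ t₀ : ℝ}
    (hq : ∀ᵐ t : ℝ ∂volume, t ∈ Icc τ ρ → q t ≤ 0) (hG0 : ∀ t, 0 ≤ g (w t))
    (hsol : IsSolR q g w v) (ht₀ : t₀ ∈ Icc τ ρ) (hv₀ : v t₀ = 0) : w t₀ ≤ w ρ := by
  have h := sub_le_of_neg_le_deriv (K := 0) hsol.1 ht₀.2 fun t ht => by
    have hle : 0 ≤ ∫ s in t₀..t, -(q s * g (w s)) := by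
      refine intervalIntegral.integral_nonneg_of_ae_restrict ht.1 ?_
      filter_upwards [ae_restrict_of_ae hq, ae_restrict_mem measurableSet_Icc] with s hs hmem
      have := mul_nonneg_of_nonpos_of_nonpos (hs ⟨ht₀.1.trans hmem.1, hmem.2.trans ht.2⟩)
        (neg_nonpos.2 (hG0 s))
      simpa using this
    rw [intervalIntegral.integral_neg] at hle
    have := hsol.2 t₀ t
    linarith
  simpa using h

/-- Translating a solution along a period of the weight gives a solution. -/
lemma IsSolR.comp_add_period {q g w v : ℝ → ℝ} {c : ℝ} (hsol : IsSolR q g w v)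
    (hq : Function.Periodic q c) : IsSolR q g (fun t => w (t + c)) fun t => v (t + c) := by
  refine ⟨fun t => (hsol.1 (t + c)).comp_add_const t c, fun t₀ t => ?_⟩
  have h := intervalIntegral.integral_comp_add_right (a := t₀) (b := t)
    (fun s => q s * g (w s)) c
  simp only [hq _] at h
  rw [h]
  exact hsol.2 _ _

/-- A point between `s 1` and `s (m + 1)` lies in one of the consecutive intervals. -/
lemma exists_mem_Icc_succ (s : ℕ → ℝ) {t : ℝ} (m : ℕ) (hm : 1 ≤ m)
    (ht : t ∈ Icc (s 1) (s (m + 1))) :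
    ∃ i, 1 ≤ i ∧ i ≤ m ∧ t ∈ Icc (s i) (s (i + 1)) := by
  induction m, hm using Nat.le_induction with
  | base => exact ⟨1, le_rfl, le_rfl, ht⟩
  | succ k hk ih =>
    rcases le_total t (s (k + 1)) with h | h
    · obtain ⟨i, hi, him, hmem⟩ := ih ⟨ht.1, h⟩
      exact ⟨i, hi, him.trans (Nat.le_succ k), hmem⟩
    · exact ⟨k + 1, by omega, le_rfl, h, ht.2⟩

/-- The iterated primitive of a non-negative function with positive integral is positive. -/
lemma integral_primitive_pos {n : ℝ → ℝ} {τ ρ : ℝ} (hn : ∀ t, 0 ≤ n t)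
    (hni : ∀ x y, IntervalIntegrable n volume x y) (hτρ : τ < ρ) (hpos : 0 < ∫ s in τ..ρ, n s) :
    0 < ∫ t in τ..ρ, ∫ s in τ..t, n s :=
  intervalIntegral.integral_pos hτρ
    (intervalIntegral.continuous_primitive hni τ).continuousOn
    (fun _ ht => intervalIntegral.integral_nonneg ht.1.le fun s _ => hn s)
    ⟨ρ, right_mem_Icc.2 hτρ.le, hpos⟩

theorem stmt_6 (g a : ℝ → ℝ) (T : ℝ) (m : ℕ) (σ τ : ℕ → ℝ)
    (hg_cont : ContinuousOn g (Ici 0)) (hg_zero : g 0 = 0)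
    (hg_pos : ∀ s : ℝ, 0 < s → 0 < g s)
    (hg0 : Tendsto (fun s => g s / s) (nhdsWithin 0 (Ioi 0)) (nhds 0))
    (hginf : Tendsto (fun s => g s / s) atTop (nhds 0))
    (hm : 1 ≤ m)
    (hστ : ∀ i, 1 ≤ i → i ≤ m → σ i < τ i)
    (hτσ : ∀ i, 1 ≤ i → i ≤ m → τ i < σ (i + 1))
    (hσT : σ (m + 1) - σ 1 = T)
    (ha_per : ∀ t, a (t + T) = a t)
    (ha_loc : LocallyIntegrable a)
    (ha_pos : ∀ i, 1 ≤ i → i ≤ m →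
      (∀ᵐ t : ℝ ∂volume, t ∈ Icc (σ i) (τ i) → 0 ≤ a t) ∧
        0 < ∫ t in (σ i)..(τ i), a t)
    (ha_neg : ∀ i, 1 ≤ i → i ≤ m →
      (∀ᵐ t : ℝ ∂volume, t ∈ Icc (τ i) (σ (i + 1)) → a t ≤ 0) ∧
        (∫ t in (τ i)..(σ (i + 1)), a t) < 0)
    (lam mu R : ℝ) (hlam : 0 < lam) (hmu : 0 < mu) (hR : 0 < R)
    -- `ζ(R) < 1/(2λ · max_i (|I⁺_i| + |I⁻_i|) ‖a‖_{+,i})`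
    (hzeta : ∀ i, 1 ≤ i → i ≤ m →
      sSup ((fun s => g s / s) '' Icc (R / 2) R) <
        1 / (2 * lam * (((τ i - σ i) + (σ (i + 1) - τ i)) *
          ∫ t in (σ i)..(τ i), max (a t) 0)))
    -- `μ > max_i 1/(γ(R) ‖A_i‖)`
    (hmu' : ∀ i, 1 ≤ i → i ≤ m →
      1 / (sInf ((fun s => g s / s) '' Icc (R / 2) R) *
        ∫ t in (τ i)..(σ (i + 1)), ∫ s in (τ i)..t, max (-a s) 0) < mu) :
    ∀ w vw : ℝ → ℝ,
      IsSolR (fun t => lam * max (a t) 0 - mu * max (-a t) 0) g w vw →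
      (∀ t, 0 ≤ w t) → (∀ t, w t ≤ R) →
      ∀ t, w t < R := by
  have hapi : ∀ x y, IntervalIntegrable a volume x y := fun x y =>
    (ha_loc.integrableOn_isCompact isCompact_uIcc).intervalIntegrable
  have hpi : ∀ x y, IntervalIntegrable (fun t => max (a t) 0) volume x y := fun x y =>
    ⟨(hapi x y).1.pos_part, (hapi x y).2.pos_part⟩
  have hni : ∀ x y, IntervalIntegrable (fun t => max (-a t) 0) volume x y := fun x y =>
    ⟨(hapi x y).1.neg_part, (hapi x y).2.neg_part⟩
  have hT : 0 < T := by
    have hmono : ∀ k, 1 ≤ k → k ≤ m → σ 1 < σ (k + 1) := by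
      intro k hk
      induction k, hk using Nat.le_induction with
      | base => exact fun h => (hστ 1 le_rfl h).trans (hτσ 1 le_rfl h)
      | succ k hk ih =>
        exact fun h => (ih (by omega)).trans
          ((hστ (k + 1) (by omega) h).trans (hτσ (k + 1) (by omega) h))
    linarith [hmono m hm le_rfl]
  have hper : Function.Periodic (fun t => lam * max (a t) 0 - mu * max (-a t) 0) T := fun t => by
    simp only [ha_per]
  -- extremal values of `g s / s` on `[R / 2, R]`
  have hne : (Icc (R / 2) R).Nonempty := nonempty_Icc.2 (by linarith)
  have hquot : ContinuousOn (fun s => g s / s) (Icc (R / 2) R) :=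
    (hg_cont.mono fun s hs => (show (0 : ℝ) ≤ s by linarith [hs.1])).div continuousOn_id
      fun s hs => (show s ≠ 0 by linarith [hs.1])
  have hcomp := isCompact_Icc.image_of_continuousOn hquot
  set Z := sSup ((fun s => g s / s) '' Icc (R / 2) R)
  set c := sInf ((fun s => g s / s) '' Icc (R / 2) R)
  have hZ : ∀ s ∈ Icc (R / 2) R, g s / s ≤ Z := fun s hs =>
    le_csSup hcomp.bddAbove (mem_image_of_mem _ hs)
  have hc : ∀ s ∈ Icc (R / 2) R, c ≤ g s / s := fun s hs =>
    csInf_le hcomp.bddBelow (mem_image_of_mem _ hs)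
  have hZ0 : 0 ≤ Z := (div_pos (hg_pos R hR) hR).le.trans (hZ R ⟨by linarith, le_rfl⟩)
  have hc0 : 0 < c := by
    obtain ⟨s, hs, hsc⟩ := hcomp.sInf_mem (hne.image _)
    have hs0 : 0 < s := by linarith [hs.1]
    exact (div_pos (hg_pos s hs0) hs0).trans_eq hsc
  have hZg : ∀ s ∈ Icc (R / 2) R, g s ≤ Z * R := fun s hs =>
    ((div_le_iff₀ (by linarith [hs.1])).1 (hZ s hs)).trans (mul_le_mul_of_nonneg_left hs.2 hZ0)
  have hcg : ∀ s ∈ Icc (R / 2) R, c * (R / 2) ≤ g s := fun s hs =>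
    (mul_le_mul_of_nonneg_left hs.1 hc0.le).trans
      ((le_div_iff₀ (by linarith [hs.1])).1 (hc s hs))
  have hg_nonneg : ∀ s, 0 ≤ s → 0 ≤ g s := fun s hs =>
    hs.eq_or_lt.elim (fun h => by rw [← h, hg_zero]) fun h => (hg_pos s h).le
  have hslope : ∀ w v : ℝ → ℝ, (∀ t, HasDerivAt w (v t) t) → (∀ t, w t ≤ R) →
      ∀ t, w t = R → v t = 0 := fun w v hw hwR t ht =>
    IsLocalMax.hasDerivAt_eq_zero (Eventually.of_forall fun s => (hwR s).trans_eq ht.symm) (hw t)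
  have hpositive : ∀ w v : ℝ → ℝ,
      IsSolR (fun t => lam * max (a t) 0 - mu * max (-a t) 0) g w v →
      (∀ t, 0 ≤ w t) → (∀ t, w t ≤ R) → ∀ i, 1 ≤ i → i ≤ m → ∀ t ∈ Icc (σ i) (τ i),
      w t ≠ R := by
    intro w v hsol hw0 hwR i hi him t ht hwt
    have hwc : Continuous w := continuous_iff_continuousAt.2 fun t => (hsol.1 t).continuousAt
    have hP : 0 < ∫ t in (σ i)..(τ i), max (a t) 0 :=
      (ha_pos i hi him).2.trans_le (intervalIntegral.integral_mono_on (hστ i hi him).le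
        (hapi _ _) (hpi _ _) fun s _ => le_max_left _ _)
    have hN : 0 < ∫ t in (τ i)..(σ (i + 1)), max (-a t) 0 := by
      have h1 := (ha_neg i hi him).2
      have h2 : ∫ t in (τ i)..(σ (i + 1)), -a t ≤ ∫ t in (τ i)..(σ (i + 1)), max (-a t) 0 :=
        intervalIntegral.integral_mono_on (hτσ i hi him).le (hapi _ _).neg (hni _ _)
          fun s _ => le_max_left _ _
      rw [intervalIntegral.integral_neg] at h2
      linarith
    have hA := integral_primitive_pos (fun t => le_max_right (-a t) 0) hni (hτσ i hi him) hN
    refine false_of_max_mem_positivity_interval (p := fun t => max (a t) 0)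
      (n := fun t => max (-a t) 0) (g := g) (w := w) (ρ := σ (i + 1)) (c := c) (Z := Z)
      (fun t => le_max_right _ _) (fun t => le_max_right _ _) hpi hni
      ?_ (hg_cont.comp_continuous hwc hw0) (fun t => hg_nonneg _ (hw0 t)) hsol hlam hmu hR hZ0
      hwR hZg hcg ht (hτσ i hi him).le hwt (hslope w v hsol.1 hwR t hwt) ?_ ?_
    · filter_upwards [(ha_neg i hi him).1] with s hs hmem using max_eq_right (hs hmem)
    · have hlen : 0 < (τ i - σ i) + (σ (i + 1) - τ i) := by
        linarith [hστ i hi him, hτσ i hi him]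
      have := (lt_div_iff₀ (by positivity)).1 (hzeta i hi him)
      linarith
    · have := (div_lt_iff₀ (by positivity)).1 (hmu' i hi him)
      exact this
  intro w v hsol hw0 hwR t
  refine lt_of_le_of_ne (hwR t) fun hwt => ?_
  -- translate `t` into the fundamental period
  obtain ⟨k, hk, -⟩ := existsUnique_add_zsmul_mem_Ico hT t (σ 1)
  have hsol' := hsol.comp_add_period (hper.neg.zsmul k)
  set t' := t + k • T with ht'
  have hshift : w (t' + k • -T) = R := by
    rw [ht', smul_neg, add_neg_cancel_right, hwt]
  obtain ⟨i, hi, him, hmem⟩ := exists_mem_Icc_succ σ m hm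
    (t := t') ⟨hk.1, by linarith [hk.2.le]⟩
  rcases le_total t' (τ i) with h | h
  · exact hpositive _ _ hsol' (fun _ => hw0 _) (fun _ => hwR _) i hi him t' ⟨hmem.1, h⟩ hshift
  have hright : w (σ (i + 1) + k • -T) = R := by
    refine (hwR _).antisymm (hshift.symm.trans_le ?_)
    refine le_right_of_max_mem_negativity_interval (τ := τ i) (ρ := σ (i + 1)) ?_
      (fun _ => hg_nonneg _ (hw0 _)) hsol' ⟨h, hmem.2⟩
      (hslope _ _ hsol'.1 (fun _ => hwR _) t' hshift)
    filter_upwards [(ha_neg i hi him).1] with s hs hs'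
    rw [max_eq_right (hs hs')]
    have := mul_nonneg hmu.le (le_max_right (-a s) 0)
    linarith
  rcases him.lt_or_eq with hlt | rfl
  · exact hpositive _ _ hsol' (fun _ => hw0 _) (fun _ => hwR _) (i + 1) (by omega) hlt
      (σ (i + 1)) ⟨le_rfl, (hστ (i + 1) (by omega) hlt).le⟩ hright
  · refine hpositive _ _ (hsol'.comp_add_period hper) (fun _ => hw0 _) (fun _ => hwR _) 1 le_rfl
      hm (σ 1) ⟨le_rfl, (hστ 1 le_rfl hm).le⟩ ?_
    have : σ 1 + T = σ (i + 1) := by linarith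
    simpa only [this] using hright
end

section
/- For any ρ > 0 there exists λ* > 0 such that for every λ > λ* and every μ > 0 the following holds: if w is any non-negative solution of u'' + (λa⁺(t) − μa⁻(t)) g(u) = 0 defined on all of ℝ, and I⁺_{i,ℓ} := I⁺_i + ℓT is any translated positivity interval of the weight (i ∈ {1,…,m}, ℓ ∈ ℤ), then max_{t∈I⁺_{i,ℓ}} w(t) ≠ ρ. -/
open MeasureTheory Set Filter Topology

/-- An interval on which a locally integrable weight has positive integral can be shrunk from both
sides while keeping the integral positive. -/
theorem exists_shrink_integral_pos {a : ℝ → ℝ} {x y : ℝ} (ha : LocallyIntegrable a)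
    (hxy : x < y) (hint : 0 < ∫ t in x..y, a t) :
    ∃ ε, 0 < ε ∧ 2 * ε < y - x ∧ 0 < ∫ t in (x + ε)..(y - ε), a t := by
  have hii : ∀ p q, IntervalIntegrable a volume p q := fun p q =>
    (ha.integrableOn_isCompact isCompact_uIcc).intervalIntegrable
  have hF : Continuous fun s => ∫ t in (0 : ℝ)..s, a t :=
    intervalIntegral.continuous_primitive hii 0
  have hsub : ∀ p q, ∫ t in p..q, a t = (∫ t in (0 : ℝ)..q, a t) - ∫ t in (0 : ℝ)..p, a t :=
    fun p q => (intervalIntegral.integral_interval_sub_left (hii 0 q) (hii 0 p)).symm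
  have hG : Continuous fun ε => ∫ t in (x + ε)..(y - ε), a t := by
    simp_rw [hsub (x + _)]
    exact (hF.comp (continuous_const.sub continuous_id)).sub
      (hF.comp (continuous_const.add continuous_id))
  have hev : ∀ᶠ ε in 𝓝[>] (0 : ℝ), 0 < ∫ t in (x + ε)..(y - ε), a t :=
    nhdsWithin_le_nhds (hG.continuousAt.eventually (lt_mem_nhds (by simpa using hint)))
  have hsmall : ∀ᶠ ε in 𝓝[>] (0 : ℝ), ε < (y - x) / 2 :=
    nhdsWithin_le_nhds (gt_mem_nhds (by linarith))
  obtain ⟨ε, h1, h2, h3⟩ := (hev.and (hsmall.and self_mem_nhdsWithin)).exists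
  exact ⟨ε, h3, by linarith, h1⟩

/-- A nonnegative concave function on `[x, y]` attaining the value `ρ` is at least `ε ρ / (y - x)`
at distance at least `ε` from the endpoints. -/
theorem ConcaveOn.le_of_mem_Icc_shrink {w : ℝ → ℝ} {x y ε ρ t₀ t : ℝ}
    (hw : ConcaveOn ℝ (Icc x y) w) (hw0 : ∀ t ∈ Icc x y, 0 ≤ w t) (hε : 0 < ε) (hρ : 0 < ρ)
    (ht₀ : t₀ ∈ Icc x y) (hwt₀ : w t₀ = ρ) (ht : t ∈ Icc (x + ε) (y - ε)) :
    ε * ρ / (y - x) ≤ w t := by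
  obtain ⟨h1, h2⟩ := ht
  obtain ⟨h3, h4⟩ := ht₀
  have hxy : 0 < y - x := by linarith
  have hx : x ∈ Icc x y := ⟨le_rfl, by linarith⟩
  have hy : y ∈ Icc x y := ⟨by linarith, le_rfl⟩
  -- it suffices to write `t` as a convex combination with weight at least `ε / (y - x)` on `t₀`
  have key : ∀ e ∈ Icc x y, ∀ θ : ℝ, ε / (y - x) ≤ θ → θ ≤ 1 → (1 - θ) * e + θ * t₀ = t →
      ε * ρ / (y - x) ≤ w t := by
    intro e he θ hθ hθ1 hcomb
    have hθ0 : 0 ≤ θ := le_trans (by positivity) hθ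
    have := hw.2 he ⟨h3, h4⟩ (sub_nonneg.2 hθ1) hθ0 (by ring)
    simp only [smul_eq_mul, hcomb, hwt₀] at this
    calc ε * ρ / (y - x) = ε / (y - x) * ρ := by ring
      _ ≤ θ * ρ := by gcongr
      _ ≤ w t := by nlinarith [mul_nonneg (sub_nonneg.2 hθ1) (hw0 e he)]
  rcases le_total t t₀ with h | h
  · have hp : 0 < t₀ - x := by linarith
    refine key x hx ((t - x) / (t₀ - x)) ?_ ((div_le_one hp).2 (by linarith)) ?_
    · exact div_le_div₀ (by linarith) (by linarith) hp (by linarith)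
    · field_simp
      ring
  · have hp : 0 < y - t₀ := by linarith
    refine key y hy ((y - t) / (y - t₀)) ?_ ((div_le_one hp).2 (by linarith)) ?_
    · exact div_le_div₀ (by linarith) (by linarith) hp (by linarith)
    · field_simp
      ring

/-- For large `lam`, a nonnegative solution of `u'' + lam * a t * g u = 0` on an interval where the
weight `a` is nonnegative with positive integral cannot have maximum exactly `ρ`. -/
theorem exists_forall_lt_ne_of_le {g a : ℝ → ℝ} {x y ρ : ℝ}
    (hg_cont : ContinuousOn g (Ici 0)) (hg_zero : g 0 = 0) (hg_pos : ∀ s : ℝ, 0 < s → 0 < g s)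
    (ha : LocallyIntegrable a) (hxy : x < y) (ha0 : ∀ᵐ t : ℝ, t ∈ Icc x y → 0 ≤ a t)
    (hint : 0 < ∫ t in x..y, a t) (hρ : 0 < ρ) :
    ∃ L : ℝ, 0 < L ∧ ∀ lam, L < lam → ∀ w v : ℝ → ℝ, (∀ t, HasDerivAt w (v t) t) →
      (∀ s ∈ Icc x y, ∀ t ∈ Icc x y, s ≤ t → v t = v s - lam * ∫ r in s..t, a r * g (w r)) →
      (∀ t, 0 ≤ w t) → (∀ t ∈ Icc x y, w t ≤ ρ) → ∀ t₀ ∈ Icc x y, w t₀ ≠ ρ := by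
  obtain ⟨ε, hε, hεxy, hA⟩ := exists_shrink_integral_pos ha hxy hint
  set A := ∫ t in (x + ε)..(y - ε), a t
  have hlen : 0 < y - x := by linarith
  have hδ : 0 < ε * ρ / (y - x) := by positivity
  have hδρ : ε * ρ / (y - x) ≤ ρ := by
    rw [div_le_iff₀ hlen]
    nlinarith
  obtain ⟨s₀, hs₀, hmin⟩ := (isCompact_Icc (a := ε * ρ / (y - x)) (b := ρ)).exists_isMinOn
    ⟨ρ, hδρ, le_rfl⟩ (hg_cont.mono fun s hs => hδ.le.trans hs.1)
  have hγ : 0 < g s₀ := hg_pos _ (hδ.trans_le hs₀.1)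
  refine ⟨2 * ρ / (ε * (g s₀ * A)), by positivity, ?_⟩
  intro lam hlam w v hw hv hw0 hwρ t₀ ht₀ hwt₀
  have hlam0 : 0 < lam := lt_trans (by positivity) hlam
  have hg0 : ∀ s, 0 ≤ s → 0 ≤ g s := fun s hs =>
    hs.eq_or_lt.elim (fun h => h ▸ hg_zero.ge) fun h => (hg_pos s h).le
  have hwc : Continuous w := continuous_iff_continuousAt.2 fun t => (hw t).continuousAt
  have hgw : Continuous fun r => g (w r) := hg_cont.comp_continuous hwc hw0
  have haii : ∀ p q, IntervalIntegrable a volume p q := fun p q =>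
    (ha.integrableOn_isCompact isCompact_uIcc).intervalIntegrable
  have hii : ∀ p q, IntervalIntegrable (fun r => a r * g (w r)) volume p q := fun p q =>
    (haii p q).mul_continuousOn hgw.continuousOn
  have hanti : AntitoneOn v (Icc x y) := by
    intro s hs t ht hst
    rw [hv s hs t ht hst]
    have : 0 ≤ ∫ r in s..t, a r * g (w r) := by
      refine intervalIntegral.integral_nonneg_of_ae_restrict hst ?_
      refine (ae_restrict_iff' measurableSet_Icc).2 ?_
      filter_upwards [ha0] with r hr hrst
      exact mul_nonneg (hr ⟨hs.1.trans hrst.1, hrst.2.trans ht.2⟩) (hg0 _ (hw0 r))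
    nlinarith
  have hderiv : deriv w = v := funext fun t => (hw t).deriv
  have hconc : ConcaveOn ℝ (Icc x y) w := by
    refine AntitoneOn.concaveOn_of_deriv (convex_Icc x y) hwc.continuousOn
      (fun t _ => (hw t).differentiableAt.differentiableWithinAt) ?_
    rw [hderiv]
    exact hanti.mono interior_subset
  have hp : x + ε ∈ Icc x y := ⟨by linarith, by linarith⟩
  have hq : y - ε ∈ Icc x y := ⟨by linarith, by linarith⟩
  have hleft : v (x + ε) ≤ ρ / ε := by
    obtain ⟨c, hc, hvc⟩ := exists_hasDerivAt_eq_slope w v (show x < x + ε by linarith)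
      hwc.continuousOn fun t _ => hw t
    have hle := hanti ⟨hc.1.le, by linarith [hc.2]⟩ hp hc.2.le
    rw [hvc, add_sub_cancel_left] at hle
    refine hle.trans ?_
    gcongr
    linarith [hwρ _ hp, hw0 x]
  have hright : -(ρ / ε) ≤ v (y - ε) := by
    obtain ⟨c, hc, hvc⟩ := exists_hasDerivAt_eq_slope w v (show y - ε < y by linarith)
      hwc.continuousOn fun t _ => hw t
    have hle := hanti hq ⟨by linarith [hc.1], hc.2.le⟩ hc.1.le
    rw [hvc, sub_sub_cancel] at hle
    refine le_trans ?_ hle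
    rw [← neg_div]
    gcongr
    linarith [hwρ _ hq, hw0 y]
  have hlow : g s₀ * A ≤ ∫ r in (x + ε)..(y - ε), a r * g (w r) := by
    rw [← intervalIntegral.integral_const_mul]
    refine intervalIntegral.integral_mono_ae_restrict (by linarith)
      ((haii _ _).const_mul _) (hii _ _) ?_
    refine (ae_restrict_iff' measurableSet_Icc).2 ?_
    filter_upwards [ha0] with r hr hrI
    have hrxy : r ∈ Icc x y := ⟨by linarith [hrI.1], by linarith [hrI.2]⟩
    have hge : g s₀ ≤ g (w r) := hmin
      ⟨hconc.le_of_mem_Icc_shrink (fun t _ => hw0 t) hε hρ ht₀ hwt₀ hrI, hwρ r hrxy⟩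
    rw [mul_comm]
    exact mul_le_mul_of_nonneg_left hge (hr hrxy)
  have heq := hv _ hp _ hq (by linarith)
  have hupper : lam * (g s₀ * A) ≤ 2 * (ρ / ε) := by
    have := mul_le_mul_of_nonneg_left hlow hlam0.le
    linarith
  have hlower : 2 * (ρ / ε) < lam * (g s₀ * A) := by
    have := (div_lt_iff₀ (by positivity)).1 hlam
    rw [← mul_div_assoc, div_lt_iff₀ hε]
    linarith
  exact absurd hupper hlower.not_ge

theorem stmt_7 (g a : ℝ → ℝ) (T : ℝ) (m : ℕ) (σ τ : ℕ → ℝ)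
    (hg_cont : ContinuousOn g (Ici 0)) (hg_zero : g 0 = 0)
    (hg_pos : ∀ s : ℝ, 0 < s → 0 < g s)
    (hg0 : Tendsto (fun s => g s / s) (nhdsWithin 0 (Ioi 0)) (nhds 0))
    (hginf : Tendsto (fun s => g s / s) atTop (nhds 0))
    (hm : 1 ≤ m)
    (hστ : ∀ i, 1 ≤ i → i ≤ m → σ i < τ i)
    (hτσ : ∀ i, 1 ≤ i → i ≤ m → τ i < σ (i + 1))
    (hσT : σ (m + 1) - σ 1 = T)
    (ha_per : ∀ t, a (t + T) = a t)
    (ha_loc : LocallyIntegrable a)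
    (ha_pos : ∀ i, 1 ≤ i → i ≤ m →
      (∀ᵐ t : ℝ ∂volume, t ∈ Icc (σ i) (τ i) → 0 ≤ a t) ∧
        0 < ∫ t in (σ i)..(τ i), a t)
    (ha_neg : ∀ i, 1 ≤ i → i ≤ m →
      (∀ᵐ t : ℝ ∂volume, t ∈ Icc (τ i) (σ (i + 1)) → a t ≤ 0) ∧
        (∫ t in (τ i)..(σ (i + 1)), a t) < 0) :
    ∀ ρ : ℝ, 0 < ρ → ∃ lamStar : ℝ, 0 < lamStar ∧
      ∀ lam : ℝ, lamStar < lam → ∀ mu : ℝ, 0 < mu →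
        ∀ w vw : ℝ → ℝ,
          IsSolR (fun t => lam * max (a t) 0 - mu * max (-a t) 0) g w vw →
          (∀ t, 0 ≤ w t) →
          ∀ i, 1 ≤ i → i ≤ m → ∀ ℓ : ℤ,
            sSup (w '' Icc (σ i + ℓ * T) (τ i + ℓ * T)) ≠ ρ := by
  intro ρ hρ
  have hloc : ∀ i, ∃ L : ℝ, 0 < L ∧ (1 ≤ i → i ≤ m → ∀ lam, L < lam → ∀ w v : ℝ → ℝ,
      (∀ t, HasDerivAt w (v t) t) →
      (∀ s ∈ Icc (σ i) (τ i), ∀ t ∈ Icc (σ i) (τ i), s ≤ t →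
        v t = v s - lam * ∫ r in s..t, a r * g (w r)) →
      (∀ t, 0 ≤ w t) → (∀ t ∈ Icc (σ i) (τ i), w t ≤ ρ) → ∀ t₀ ∈ Icc (σ i) (τ i), w t₀ ≠ ρ) := by
    intro i
    by_cases hi : 1 ≤ i ∧ i ≤ m
    · obtain ⟨L, hL, h⟩ := exists_forall_lt_ne_of_le hg_cont hg_zero hg_pos ha_loc
        (hστ i hi.1 hi.2) (ha_pos i hi.1 hi.2).1 (ha_pos i hi.1 hi.2).2 hρ
      exact ⟨L, hL, fun _ _ => h⟩
    · exact ⟨1, one_pos, fun h1 h2 => absurd ⟨h1, h2⟩ hi⟩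
  choose L hL hmain using hloc
  refine ⟨∑ i ∈ Finset.Icc 1 m, L i,
    Finset.sum_pos (fun i _ => hL i) (Finset.nonempty_Icc.2 hm), ?_⟩
  intro lam hlam mu _ w vw hsol hw0 i hi1 him ℓ hsup
  have hLi : L i < lam := (Finset.single_le_sum (f := L) (fun j _ => (hL j).le)
    (Finset.mem_Icc.2 ⟨hi1, him⟩)).trans_lt hlam
  have hwc : Continuous w := continuous_iff_continuousAt.2 fun t => (hsol.1 t).continuousAt
  have hne : (Icc (σ i + ℓ * T) (τ i + ℓ * T)).Nonempty :=
    nonempty_Icc.2 (by linarith [hστ i hi1 him])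
  obtain ⟨t₁, ht₁, hwt₁⟩ := isCompact_Icc.exists_sSup_image_eq hne hwc.continuousOn
  have hbdd := (isCompact_Icc (a := σ i + ℓ * T) (b := τ i + ℓ * T)).bddAbove_image
    hwc.continuousOn
  have hper : ∀ t, a (t + ℓ * T) = a t := (show Function.Periodic a T from ha_per).int_mul ℓ
  refine hmain i hi1 him lam hLi (fun t => w (t + ℓ * T)) (fun t => vw (t + ℓ * T))
    (fun t => (hsol.1 _).comp_add_const t (ℓ * T)) ?_ (fun t => hw0 _) ?_ (t₁ - ℓ * T)
    ⟨by linarith [ht₁.1], by linarith [ht₁.2]⟩ ?_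
  · intro s hs t ht hst
    rw [hsol.2 (s + ℓ * T) (t + ℓ * T), ← intervalIntegral.integral_comp_add_right,
      ← intervalIntegral.integral_const_mul]
    congr 1
    refine intervalIntegral.integral_congr_ae ?_
    filter_upwards [(ha_pos i hi1 him).1] with r hr hrst
    rw [uIoc_of_le hst] at hrst
    have har := hr ⟨hs.1.trans hrst.1.le, hrst.2.trans ht.2⟩
    rw [hper, max_eq_left har, max_eq_right (by linarith)]
    ring
  · intro t ht
    rw [← hsup]
    exact le_csSup hbdd (mem_image_of_mem w ⟨by linarith [ht.1], by linarith [ht.2]⟩)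
  · simp only [sub_add_cancel]
    rw [← hwt₁, hsup]
end

section
/- Assume λ > 0 and 0 < r < R satisfy ζ(d) < 1/(2λ · max_{i=1,…,m}(|I⁺_i| + |I⁻_i|)‖a‖_{+,i}) for all 0 < d ≤ r. Then for every ε with 0 < ε ≤ r there exists μ★_ε > 0 such that for every μ > μ★_ε the following holds: if w is a non-negative solution of u'' + (λa⁺(t) − μa⁻(t)) g(u) = 0 on all of ℝ with sup_{t∈ℝ} w(t) ≤ R and max_{t∈I⁺_{i,ℓ}} w(t) ≤ r for some i ∈ {1,…,m}, ℓ ∈ ℤ (with I⁺_{i,ℓ} := I⁺_i + ℓT), then max_{t∈I⁺_{i,ℓ}} w(t) < ε. -/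
open MeasureTheory Set Filter Topology

section PhasePlaneEstimates

variable {g a w v : ℝ → ℝ} {lam mu : ℝ}

/-- A lower bound on the derivative bounds the increment from below. -/
lemma add_mul_le_of_le_hasDerivAt (hw : ∀ t, HasDerivAt w (v t) t) {x y C : ℝ} (hxy : x ≤ y)
    (hC : ∀ t ∈ Ioo x y, C ≤ v t) : w x + C * (y - x) ≤ w y := by
  have h := (convex_Icc x y).mul_sub_le_image_sub_of_le_deriv (f := w) (C := C)
    (fun t _ => (hw t).continuousAt.continuousWithinAt)
    (fun t _ => (hw t).differentiableAt.differentiableWithinAt)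
    (fun t ht => by rw [(hw t).deriv]; exact hC t (by simpa using ht))
    x (left_mem_Icc.2 hxy) y (right_mem_Icc.2 hxy) hxy
  linarith

/-- An upper bound on the derivative bounds the increment from above. -/
lemma le_add_mul_of_hasDerivAt_le (hw : ∀ t, HasDerivAt w (v t) t) {x y C : ℝ} (hxy : x ≤ y)
    (hC : ∀ t ∈ Ioo x y, v t ≤ C) : w y ≤ w x + C * (y - x) := by
  have h := add_mul_le_of_le_hasDerivAt (w := fun t => -w t) (v := fun t => -v t)
    (fun t => (hw t).neg) (C := -C) hxy (fun t ht => neg_le_neg (hC t ht))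
  linarith

lemma IsSolR.comp_add_right {q : ℝ → ℝ} {p : ℝ} (h : IsSolR q g w v)
    (hq : ∀ t, q (t + p) = q t) :
    IsSolR q g (fun t => w (t + p)) (fun t => v (t + p)) := by
  refine ⟨fun t => (h.1 (t + p)).comp_add_const t p, fun t₀ t => ?_⟩
  have key := intervalIntegral.integral_comp_add_right (a := t₀) (b := t)
    (fun s => q s * g (w s)) p
  simp only [hq] at key
  rw [key]
  exact h.2 _ _

lemma intervalIntegrable_max_zero (ha : LocallyIntegrable a) (x y : ℝ) :
    IntervalIntegrable (fun t => max (a t) 0) volume x y :=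
  have h := (ha.integrableOn_isCompact isCompact_uIcc).intervalIntegrable (a := x) (b := y)
  ⟨h.1.pos_part, h.2.pos_part⟩

lemma intervalIntegrable_weight_mul (ha : LocallyIntegrable a)
    (hgw : Continuous fun t => g (w t)) (x y : ℝ) :
    IntervalIntegrable (fun t => (lam * max (a t) 0 - mu * max (-a t) 0) * g (w t))
      volume x y :=
  (((intervalIntegrable_max_zero ha x y).const_mul lam).sub
    ((intervalIntegrable_max_zero ha.neg x y).const_mul mu)).mul_continuousOn hgw.continuousOn

/-- On an interval where the weight is non-positive the derivative of a solution grows at least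
like `mu * γ * ∫ a⁻`, when `γ ≤ g ∘ w`. -/
lemma IsSolR.mul_integral_le_sub
    (h : IsSolR (fun t => lam * max (a t) 0 - mu * max (-a t) 0) g w v)
    (ha : LocallyIntegrable a) (hgw : Continuous fun t => g (w t)) (hmu : 0 ≤ mu)
    {x y γ : ℝ} (hxy : x ≤ y) (hneg : ∀ᵐ t : ℝ ∂volume, t ∈ Icc x y → a t ≤ 0)
    (hγ : ∀ t ∈ Icc x y, γ ≤ g (w t)) :
    mu * γ * (∫ t in x..y, max (-a t) 0) ≤ v y - v x := by
  have hv := h.2 x y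
  have hle : ∫ s in x..y, (lam * max (a s) 0 - mu * max (-a s) 0) * g (w s) ≤
      ∫ s in x..y, -(mu * γ) * max (-a s) 0 := by
    refine intervalIntegral.integral_mono_ae_restrict hxy
      (intervalIntegrable_weight_mul ha hgw x y)
      ((intervalIntegrable_max_zero ha.neg x y).const_mul _) ?_
    filter_upwards [ae_restrict_of_ae hneg, ae_restrict_mem measurableSet_Icc] with t ht hmem
    have h1 : max (a t) 0 = 0 := max_eq_right (ht hmem)
    have h2 := mul_le_mul_of_nonneg_left (hγ t hmem)
      (mul_nonneg hmu (le_max_right (-a t) 0))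
    simp only [h1]
    linarith
  rw [intervalIntegral.integral_const_mul] at hle
  linarith

lemma integral_max_neg_zero_pos (ha : LocallyIntegrable a) {p q : ℝ} (hpq : p < q)
    (hint : (∫ t in p..q, a t) < 0) : 0 < ∫ t in p..q, max (-a t) 0 := by
  have h : ∫ t in p..q, -a t ≤ ∫ t in p..q, max (-a t) 0 :=
    intervalIntegral.integral_mono hpq.le
      (ha.integrableOn_isCompact isCompact_uIcc).intervalIntegrable.neg
      (intervalIntegrable_max_zero ha.neg p q) (fun t => le_max_left _ _)
  rw [intervalIntegral.integral_neg] at h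
  linarith

/-- For large `mu`, no solution with values in `[0, R]` leaves the left endpoint of a negativity
interval with slope at least `-C` while keeping `g ∘ w` above `γ`. -/
lemma eventually_not_isSolR_of_le_slope_left (ha : LocallyIntegrable a) {p q : ℝ} (hpq : p < q)
    (hneg : ∀ᵐ t : ℝ ∂volume, t ∈ Icc p q → a t ≤ 0) (hint : (∫ t in p..q, a t) < 0)
    {γ : ℝ} (hγ : 0 < γ) (C R : ℝ) :
    ∀ᶠ mu in atTop, ∀ w v : ℝ → ℝ,
      IsSolR (fun t => lam * max (a t) 0 - mu * max (-a t) 0) g w v →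
      (Continuous fun t => g (w t)) → (∀ t, 0 ≤ w t) → (∀ t, w t ≤ R) → -C ≤ v p →
      ¬ ∀ t ∈ Icc p q, γ ≤ g (w t) := by
  have hF : Continuous fun y => ∫ t in p..y, max (-a t) 0 :=
    intervalIntegral.continuous_primitive (fun x y => intervalIntegrable_max_zero ha.neg x y) p
  have hev : ∀ᶠ y in 𝓝[<] q, 0 < ∫ t in p..y, max (-a t) 0 :=
    nhdsWithin_le_nhds (hF.continuousAt.eventually
      (lt_mem_nhds (integral_max_neg_zero_pos ha hpq hint)))
  obtain ⟨c, hB, hc⟩ := (hev.and (Ioo_mem_nhdsLT hpq)).exists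
  set B := ∫ t in p..c, max (-a t) 0 with hBdef
  have hpos : 0 < γ * B * (q - c) := mul_pos (mul_pos hγ hB) (sub_pos.2 hc.2)
  filter_upwards [eventually_ge_atTop 0,
    (tendsto_id.atTop_mul_const hpos).eventually_gt_atTop (R + C * (q - p))]
    with mu hmu hlarge w v h hgw hw0 hwR hvp hγw
  have hgrow : ∀ y ∈ Icc p q, mu * γ * (∫ t in p..y, max (-a t) 0) ≤ v y - v p :=
    fun y hy => h.mul_integral_le_sub ha hgw hmu hy.1
      (hneg.mono fun t ht hm => ht ⟨hm.1, hm.2.trans hy.2⟩)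
      (fun t ht => hγw t ⟨ht.1, ht.2.trans hy.2⟩)
  have h1 : w p + (-C) * (c - p) ≤ w c := by
    refine add_mul_le_of_le_hasDerivAt h.1 hc.1.le fun t ht => ?_
    have hnn : 0 ≤ ∫ s in p..t, max (-a s) 0 :=
      intervalIntegral.integral_nonneg ht.1.le fun s _ => le_max_right _ _
    have := hgrow t ⟨ht.1.le, ht.2.le.trans hc.2.le⟩
    have := mul_nonneg (mul_nonneg hmu hγ.le) hnn
    linarith
  have h2 : w c + (-C + mu * γ * B) * (q - c) ≤ w q := by
    refine add_mul_le_of_le_hasDerivAt h.1 hc.2.le fun t ht => ?_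
    have hmono : B ≤ ∫ s in p..t, max (-a s) 0 :=
      intervalIntegral.integral_mono_interval le_rfl hc.1.le ht.1.le
        (Eventually.of_forall fun s => le_max_right _ _)
        (intervalIntegrable_max_zero ha.neg p t)
    have := hgrow t ⟨hc.1.le.trans ht.1.le, ht.2.le⟩
    have := mul_le_mul_of_nonneg_left hmono (mul_nonneg hmu hγ.le)
    linarith
  have h3 : R + C * (q - p) < mu * (γ * B * (q - c)) := hlarge
  nlinarith [hw0 p, hwR q]

/-- For large `mu`, no solution with values in `[0, R]` reaches the right endpoint of a negativity
interval with non-positive slope while keeping `g ∘ w` above `γ`. -/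
lemma eventually_not_isSolR_of_slope_right_le (ha : LocallyIntegrable a) {p q : ℝ} (hpq : p < q)
    (hneg : ∀ᵐ t : ℝ ∂volume, t ∈ Icc p q → a t ≤ 0) (hint : (∫ t in p..q, a t) < 0)
    {γ : ℝ} (hγ : 0 < γ) (R : ℝ) :
    ∀ᶠ mu in atTop, ∀ w v : ℝ → ℝ,
      IsSolR (fun t => lam * max (a t) 0 - mu * max (-a t) 0) g w v →
      (Continuous fun t => g (w t)) → (∀ t, 0 ≤ w t) → (∀ t, w t ≤ R) → v q ≤ 0 →
      ¬ ∀ t ∈ Icc p q, γ ≤ g (w t) := by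
  have ha' : LocallyIntegrable fun t => a (-t) := by
    rw [locallyIntegrable_iff]
    intro K hK
    have := (locallyIntegrable_iff.1 ha) (-K) hK.neg
    simpa using this.comp_neg
  have hneg' : ∀ᵐ t : ℝ ∂volume, t ∈ Icc (-q) (-p) → a (-t) ≤ 0 := by
    have := (Measure.measurePreserving_neg (volume : Measure ℝ)).quasiMeasurePreserving.ae hneg
    filter_upwards [this] with t ht hm
    exact ht ⟨by linarith [hm.2], by linarith [hm.1]⟩
  have hint' : (∫ t in (-q)..(-p), a (-t)) < 0 := by
    simpa using hint
  filter_upwards [eventually_not_isSolR_of_le_slope_left (lam := lam) (g := g) ha'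
    (neg_lt_neg hpq) hneg' hint' hγ 0 R] with mu hmu w v h hgw hw0 hwR hvq hγw
  refine hmu (fun t => w (-t)) (fun t => -v (-t)) ⟨fun t => ?_, fun t₀ t => ?_⟩
    (hgw.comp continuous_neg) (fun t => hw0 _) (fun t => hwR _) (by simpa using hvq)
    fun t ht => hγw _ ⟨by linarith [ht.2], by linarith [ht.1]⟩
  · simpa [Function.comp_def] using (h.1 (-t)).scomp t (hasDerivAt_neg t)
  · have key := intervalIntegral.integral_comp_neg (a := t₀) (b := t)
      (fun s => (lam * max (a s) 0 - mu * max (-a s) 0) * g (w s))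
    have hv := h.2 (-t) (-t₀)
    simp only at key hv ⊢
    rw [key]
    linarith

/-- If a solution attains its maximum `d` over `[σ, τ]` at `x` with non-negative slope, and
`g s ≤ Z * s` on `[d/2, d]` with `Z` small, then it decreases with slope at least `-d / (2L)`
on `[x, τ]`. -/
lemma IsSolR.neg_le_slope_of_isMax
    (h : IsSolR (fun t => lam * max (a t) 0 - mu * max (-a t) 0) g w v)
    (ha : LocallyIntegrable a) (hgw : Continuous fun t => g (w t)) (hlam : 0 ≤ lam)
    (hmu : 0 ≤ mu) (hg0 : ∀ t, 0 ≤ g (w t)) {σ τ x d L Z : ℝ} (hx : x ∈ Icc σ τ)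
    (hd : 0 < d) (hmax : ∀ t ∈ Icc σ τ, w t ≤ d) (hwx : w x = d) (hvx : 0 ≤ v x)
    (hL : 0 < L) (hτL : τ - σ ≤ L) (hZ0 : 0 ≤ Z) (hZ : ∀ s ∈ Icc (d / 2) d, g s ≤ Z * s)
    (hsmall : 2 * lam * L * Z * (∫ t in σ..τ, max (a t) 0) < 1) :
    ∀ t ∈ Icc x τ, -(d / (2 * L)) ≤ v t := by
  set A := ∫ t in σ..τ, max (a t) 0 with hA
  set K := lam * Z * d * A with hK
  have hA0 : 0 ≤ A :=
    intervalIntegral.integral_nonneg (hx.1.trans hx.2) fun s _ => le_max_right _ _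
  have hK0 : 0 ≤ K := by positivity
  have hKL : K * (2 * L) < d := by
    have := mul_lt_mul_of_pos_right hsmall hd
    rw [hK]; linarith
  have hslope : ∀ t ∈ Icc x τ, (∀ s ∈ Icc x t, d / 2 ≤ w s) → -K ≤ v t := by
    intro t ht hlow
    have h1 : ∫ s in x..t, (lam * max (a s) 0 - mu * max (-a s) 0) * g (w s) ≤
        ∫ s in x..t, (lam * Z * d) * max (a s) 0 := by
      refine intervalIntegral.integral_mono_on ht.1
        (intervalIntegrable_weight_mul ha hgw x t)
        ((intervalIntegrable_max_zero ha x t).const_mul _) fun s hs => ?_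
      have hwd := hmax s ⟨hx.1.trans hs.1, hs.2.trans ht.2⟩
      have h2 : g (w s) ≤ Z * d :=
        (hZ _ ⟨hlow s hs, hwd⟩).trans (mul_le_mul_of_nonneg_left hwd hZ0)
      have h3 := mul_nonneg (mul_nonneg hmu (le_max_right (-a s) 0)) (hg0 s)
      have h4 := mul_le_mul_of_nonneg_left h2 (mul_nonneg hlam (le_max_right (a s) 0))
      linarith
    have h2 : ∫ s in x..t, max (a s) 0 ≤ A :=
      intervalIntegral.integral_mono_interval hx.1 ht.1 ht.2
        (Eventually.of_forall fun s => le_max_right _ _) (intervalIntegrable_max_zero ha σ τ)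
    have h3 := mul_le_mul_of_nonneg_left h2 (by positivity : 0 ≤ lam * Z * d)
    rw [intervalIntegral.integral_const_mul] at h1
    have := h.2 x t
    linarith
  have hwc : Continuous w := continuous_iff_continuousAt.2 fun t => (h.1 t).continuousAt
  have hlow : ∀ t ∈ Icc x τ, d / 2 < w t := by
    by_contra! hcon
    obtain ⟨t₁, ht₁, hwt₁⟩ := hcon
    have hcomp : IsCompact (Icc x τ ∩ {t | w t ≤ d / 2}) :=
      isCompact_Icc.inter_right (isClosed_le hwc continuous_const)
    obtain ⟨s, ⟨hs, hws⟩, hsmin⟩ := hcomp.exists_isLeast ⟨t₁, ht₁, hwt₁⟩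
    have hbefore : ∀ t ∈ Ioo x s, -K ≤ v t := by
      refine fun t ht => hslope t ⟨ht.1.le, ht.2.le.trans hs.2⟩ fun y hy => ?_
      by_contra! hlt
      have := hsmin ⟨⟨hy.1, hy.2.trans (ht.2.le.trans hs.2)⟩, hlt.le⟩
      linarith [hy.2, ht.2]
    have h1 := add_mul_le_of_le_hasDerivAt h.1 hs.1 hbefore
    have h2 : s - x ≤ L := by linarith [hs.2, hx.1]
    have h3 := mul_le_mul_of_nonneg_left h2 hK0
    simp only [mem_ofPred_eq] at hws
    linarith
  intro t ht
  have h1 := hslope t ht fun s hs => (hlow s ⟨hs.1, hs.2.trans ht.2⟩).le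
  have h2 : K ≤ d / (2 * L) := (le_div_iff₀ (by positivity)).2 hKL.le
  linarith

end PhasePlaneEstimates

theorem stmt_9 (g a : ℝ → ℝ) (T : ℝ) (m : ℕ) (σ τ : ℕ → ℝ)
    (hg_cont : ContinuousOn g (Ici 0)) (hg_zero : g 0 = 0)
    (hg_pos : ∀ s : ℝ, 0 < s → 0 < g s)
    (hg0 : Tendsto (fun s => g s / s) (nhdsWithin 0 (Ioi 0)) (nhds 0))
    (hginf : Tendsto (fun s => g s / s) atTop (nhds 0))
    (hm : 1 ≤ m)
    (hστ : ∀ i, 1 ≤ i → i ≤ m → σ i < τ i)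
    (hτσ : ∀ i, 1 ≤ i → i ≤ m → τ i < σ (i + 1))
    (hσT : σ (m + 1) - σ 1 = T)
    (ha_per : ∀ t, a (t + T) = a t)
    (ha_loc : LocallyIntegrable a)
    (ha_pos : ∀ i, 1 ≤ i → i ≤ m →
      (∀ᵐ t : ℝ ∂volume, t ∈ Icc (σ i) (τ i) → 0 ≤ a t) ∧
        0 < ∫ t in (σ i)..(τ i), a t)
    (ha_neg : ∀ i, 1 ≤ i → i ≤ m →
      (∀ᵐ t : ℝ ∂volume, t ∈ Icc (τ i) (σ (i + 1)) → a t ≤ 0) ∧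
        (∫ t in (τ i)..(σ (i + 1)), a t) < 0)
    (lam r R : ℝ) (hlam : 0 < lam) (hr : 0 < r) (hrR : r < R)
    -- `ζ(d) < 1/(2λ · max_i (|I⁺_i| + |I⁻_i|) ‖a‖_{+,i})` for all `0 < d ≤ r`
    (hzeta : ∀ d : ℝ, 0 < d → d ≤ r → ∀ i, 1 ≤ i → i ≤ m →
      sSup ((fun s => g s / s) '' Icc (d / 2) d) <
        1 / (2 * lam * (((τ i - σ i) + (σ (i + 1) - τ i)) *
          ∫ t in (σ i)..(τ i), max (a t) 0))) :
    ∀ ε : ℝ, 0 < ε → ε ≤ r → ∃ muStar : ℝ, 0 < muStar ∧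
      ∀ mu : ℝ, muStar < mu →
        ∀ w vw : ℝ → ℝ,
          IsSolR (fun t => lam * max (a t) 0 - mu * max (-a t) 0) g w vw →
          (∀ t, 0 ≤ w t) → (∀ t, w t ≤ R) →
          ∀ i, 1 ≤ i → i ≤ m → ∀ ℓ : ℤ,
            sSup (w '' Icc (σ i + ℓ * T) (τ i + ℓ * T)) ≤ r →
            sSup (w '' Icc (σ i + ℓ * T) (τ i + ℓ * T)) < ε := by
  intro ε hε hεr
  have hper : ∀ (n : ℤ) (t : ℝ), a (t + n * T) = a t :=
    fun n t => Function.Periodic.int_mul (f := a) ha_per n t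
  obtain ⟨γ, hγ, hγg⟩ : ∃ γ, 0 < γ ∧ ∀ s ∈ Icc (ε / 2) R, γ ≤ g s := by
    obtain ⟨s, hs, hmin⟩ := (isCompact_Icc (a := ε / 2) (b := R)).exists_isMinOn
      ⟨R, by linarith, le_rfl⟩ (hg_cont.mono fun t ht => (half_pos hε).le.trans ht.1)
    exact ⟨g s, hg_pos s ((half_pos hε).trans_le hs.1), fun t ht => hmin ht⟩
  have hev : ∀ᶠ mu in atTop, ∀ i ∈ Finset.Icc 1 m, (∀ w v : ℝ → ℝ,
      IsSolR (fun t => lam * max (a t) 0 - mu * max (-a t) 0) g w v →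
      (Continuous fun t => g (w t)) → (∀ t, 0 ≤ w t) → (∀ t, w t ≤ R) →
      -(r / (2 * (σ (i + 1) - σ i))) ≤ v (τ i) →
      ¬ ∀ t ∈ Icc (τ i) (σ (i + 1)), γ ≤ g (w t)) ∧ (∀ w v : ℝ → ℝ,
      IsSolR (fun t => lam * max (a t) 0 - mu * max (-a t) 0) g w v →
      (Continuous fun t => g (w t)) → (∀ t, 0 ≤ w t) → (∀ t, w t ≤ R) → v (σ (i + 1)) ≤ 0 →
      ¬ ∀ t ∈ Icc (τ i) (σ (i + 1)), γ ≤ g (w t)) := by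
    rw [Filter.eventually_all_finset]
    intro i hi
    obtain ⟨h1, h2⟩ := Finset.mem_Icc.1 hi
    exact (eventually_not_isSolR_of_le_slope_left ha_loc (hτσ i h1 h2) (ha_neg i h1 h2).1
      (ha_neg i h1 h2).2 hγ _ R).and
      (eventually_not_isSolR_of_slope_right_le ha_loc (hτσ i h1 h2) (ha_neg i h1 h2).1
      (ha_neg i h1 h2).2 hγ R)
  obtain ⟨M, hM⟩ := eventually_atTop.1 hev
  refine ⟨max M 1, by positivity, fun mu hmu => ?_⟩
  have hmu0 : 0 ≤ mu := zero_le_one.trans ((le_max_right M 1).trans hmu.le)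
  have hno := hM mu ((le_max_left M 1).trans hmu.le)
  -- It suffices to treat the case of no translation.
  suffices key : ∀ w v : ℝ → ℝ,
      IsSolR (fun t => lam * max (a t) 0 - mu * max (-a t) 0) g w v →
      (∀ t, 0 ≤ w t) → (∀ t, w t ≤ R) → ∀ i, 1 ≤ i → i ≤ m →
      ∀ x ∈ Icc (σ i) (τ i), IsMaxOn w (Icc (σ i) (τ i)) x → w x ≤ r → w x < ε by
    intro w v h hw0 hwR i hi1 him ℓ hsup
    have hwc : Continuous w := continuous_iff_continuousAt.2 fun t => (h.1 t).continuousAt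
    obtain ⟨x, hx, hxsup, hxmax⟩ := isCompact_Icc.exists_sSup_image_eq_and_ge
      (nonempty_Icc.2 (add_le_add_left (hστ i hi1 him).le (ℓ * T))) hwc.continuousOn
    rw [hxsup] at hsup ⊢
    have := key (fun t => w (t + ℓ * T)) _
      (h.comp_add_right fun t => by simp only [hper]) (fun t => hw0 _) (fun t => hwR _)
      i hi1 him (x - ℓ * T) ⟨by linarith [hx.1], by linarith [hx.2]⟩
      (fun t ht => by
        simpa using hxmax (t + ℓ * T) ⟨by linarith [ht.1], by linarith [ht.2]⟩)
      (by simpa using hsup)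
    simpa using this
  intro w v h hw0 hwR i hi1 him x hx hmax hxr
  by_contra! hxε
  have hwc : Continuous w := continuous_iff_continuousAt.2 fun t => (h.1 t).continuousAt
  have hgw : Continuous fun t => g (w t) := hg_cont.comp_continuous hwc hw0
  have hgnn : ∀ s, 0 ≤ s → 0 ≤ g s := fun s hs =>
    hs.eq_or_lt.elim (fun h0 => by rw [← h0, hg_zero]) fun h0 => (hg_pos s h0).le
  have hστi := hστ i hi1 him
  have hτσi := hτσ i hi1 him
  have hd : 0 < w x := hε.trans_le hxε
  by_cases hvx : 0 ≤ v x
  · -- The solution stays above `w x / 2` on the whole negativity interval to the right.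
    set d := w x with hddef
    set Z := sSup ((fun s => g s / s) '' Icc (d / 2) d) with hZdef
    have hZle : ∀ s ∈ Icc (d / 2) d, g s / s ≤ Z := by
      refine fun s hs => le_csSup (IsCompact.bddAbove ?_) ⟨s, hs, rfl⟩
      refine isCompact_Icc.image_of_continuousOn (ContinuousOn.div ?_ continuousOn_id ?_)
      · exact hg_cont.mono fun t ht => (half_pos hd).le.trans ht.1
      · exact fun t ht => ((half_pos hd).trans_le ht.1).ne'
    have hZpos : 0 < Z := (div_pos (hg_pos d hd) hd).trans_le (hZle d ⟨by linarith, le_rfl⟩)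
    have hz := hzeta d hd hxr i hi1 him
    have hden := one_div_pos.1 (hZpos.trans hz)
    rw [lt_div_iff₀ hden] at hz
    have hslope := h.neg_le_slope_of_isMax ha_loc hgw hlam.le hmu0 (fun t => hgnn _ (hw0 t)) hx
      hd (fun t ht => hmax ht) rfl hvx (L := σ (i + 1) - σ i) (by linarith) (by linarith)
      hZpos.le (fun s hs => (div_le_iff₀ ((half_pos hd).trans_le hs.1)).1 (hZle s hs))
      (by linarith)
    have hL : 0 < 2 * (σ (i + 1) - σ i) := by linarith
    have hvτ := hslope (τ i) ⟨hx.2, le_rfl⟩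
    refine (hno i (Finset.mem_Icc.2 ⟨hi1, him⟩)).1 w v h hgw hw0 hwR ?_ fun t ht => ?_
    · exact (neg_le_neg (div_le_div_of_nonneg_right hxr hL.le)).trans hvτ
    · refine hγg _ ⟨?_, hwR t⟩
      have h1 : w x + -(d / (2 * (σ (i + 1) - σ i))) * (t - x) ≤ w t := by
        refine add_mul_le_of_le_hasDerivAt h.1 (hx.2.trans ht.1) fun s hs => ?_
        rcases le_total s (τ i) with hsτ | hsτ
        · exact hslope s ⟨hs.1.le, hsτ⟩
        · have := h.mul_integral_le_sub ha_loc hgw hmu0 (γ := 0) hsτ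
            ((ha_neg i hi1 him).1.mono fun y hy hm => hy ⟨hm.1, hm.2.trans (hs.2.le.trans ht.2)⟩)
            (fun y _ => hgnn _ (hw0 y))
          linarith
      have h2 : d / (2 * (σ (i + 1) - σ i)) * (t - x) ≤
          d / (2 * (σ (i + 1) - σ i)) * (σ (i + 1) - σ i) :=
        mul_le_mul_of_nonneg_left (by linarith [ht.2, hx.1]) (by positivity)
      have h3 : d / (2 * (σ (i + 1) - σ i)) * (σ (i + 1) - σ i) = d / 2 := by
        have : σ (i + 1) - σ i ≠ 0 := by linarith
        field_simp
      linarith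
  · -- The maximum is at the left endpoint; go back to the preceding negativity interval.
    push Not at hvx
    have hxσ : x = σ i := by
      refine hx.1.antisymm' (not_lt.1 fun hlt => ?_)
      have htend := (h.1 x).tendsto_slope.mono_left (nhdsLT_le_nhdsNE x)
      refine hvx.not_ge (ge_of_tendsto htend ?_)
      filter_upwards [Ioo_mem_nhdsLT hlt] with t ht
      rw [slope_def_field]
      exact div_nonneg_of_nonpos (sub_nonpos.2 (hmax ⟨ht.1.le, ht.2.le.trans hx.2⟩))
        (sub_nonpos.2 ht.2.le)
    obtain ⟨j, n, hj1, hjm, hjn⟩ : ∃ (j : ℕ) (n : ℤ), 1 ≤ j ∧ j ≤ m ∧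
        σ (j + 1) + n * T = σ i := by
      rcases hi1.eq_or_lt with rfl | hi
      · exact ⟨m, -1, hm, le_rfl, by push_cast; linarith⟩
      · exact ⟨i - 1, 0, by omega, by omega, by rw [Nat.sub_add_cancel hi1]; simp⟩
    have h' := h.comp_add_right (p := n * T) fun t => by simp only [hper]
    have hgw' : Continuous fun t => g (w (t + n * T)) := hgw.comp (continuous_add_const _)
    have hvσ : v (σ (j + 1) + n * T) < 0 := by rwa [hjn, ← hxσ]
    refine (hno j (Finset.mem_Icc.2 ⟨hj1, hjm⟩)).2 _ _ h' hgw' (fun t => hw0 _)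
      (fun t => hwR _) hvσ.le fun t ht => hγg _ ⟨?_, hwR _⟩
    have h1 := le_add_mul_of_hasDerivAt_le h'.1 (C := 0) ht.2 fun s hs => by
      have := h'.mul_integral_le_sub ha_loc hgw' hmu0 (γ := 0) hs.2.le
        ((ha_neg j hj1 hjm).1.mono fun y hy hm => hy ⟨ht.1.trans (hs.1.le.trans hm.1), hm.2⟩)
        (fun y _ => hgnn _ (hw0 _))
      linarith
    rw [hjn, ← hxσ] at h1
    linarith
end

section
/- Let f : ℝ × ℝ^d → ℝ^d be an L¹-Carathéodory function. Let (t_n) be an increasing sequence of positive numbers with t_n → +∞, and let (x_n) be a sequence of functions such that, for each n, x_n is a Carathéodory solution of x' = f(t,x) defined on [−t_n, t_n], and there is a closed bounded set B ⊆ ℝ^d with x_n(t) ∈ B for all n and all t ∈ [−t_n, t_n]. Then there is a subsequence of (x_n) converging uniformly on every compact subset of ℝ to a Carathéodory solution x̃ of x' = f(t,x) defined on all of ℝ with x̃(t) ∈ B for all t ∈ ℝ. -/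
open MeasureTheory Set Filter Topology

/-- The superposition of a Carathéodory function with a continuous function is a.e. strongly
measurable. -/
theorem aestronglyMeasurable_caratheodory_comp {E F : Type*} [TopologicalSpace E]
    [TopologicalSpace.MetrizableSpace E] [SecondCountableTopology E]
    [NormedAddCommGroup F] [MeasurableSpace F] [BorelSpace F] [SecondCountableTopology F]
    {f : ℝ → E → F} (hf_meas : ∀ x, Measurable fun t => f t x)
    (hf_cont : ∀ᵐ t : ℝ ∂volume, Continuous fun x => f t x)
    {y : ℝ → E} (hy : Continuous y) :
    AEStronglyMeasurable (fun t => f t (y t)) volume := by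
  borelize E
  obtain ⟨G, hG, hG_meas, hG_cont⟩ := hf_cont.exists_measurable_mem
  have h_joint : StronglyMeasurable
      (Function.uncurry fun (x : E) (t : ℝ) => G.indicator (fun t => f t x) t) := by
    refine stronglyMeasurable_uncurry_of_continuous_of_stronglyMeasurable (fun t => ?_) fun x =>
      ((hf_meas x).indicator hG_meas).stronglyMeasurable
    by_cases ht : t ∈ G
    · simpa [ht] using hG_cont t ht
    · simpa [ht] using continuous_const
  refine ⟨fun t => G.indicator (fun s => f s (y t)) t,
    h_joint.comp_measurable (hy.measurable.prodMk measurable_id), ?_⟩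
  filter_upwards [hG] with t ht
  simp [ht]

/-- Continuous functions with values in a compact set and a common modulus of continuity
controlled by a continuous function form a compact set in the compact-open topology. -/
theorem isCompact_setOf_dist_le {X E : Type*} [TopologicalSpace X] [MetricSpace E]
    {H : X → ℝ} (hH : Continuous H) {B : Set E} (hB : IsCompact B) :
    IsCompact {g : C(X, E) | (∀ t, g t ∈ B) ∧ ∀ s t, dist (g s) (g t) ≤ |H s - H t|} := by
  have hmod (t : X) : Tendsto (fun s => |H t - H s|) (𝓝 t) (𝓝 0) := by
    have : Continuous fun s => |H t - H s| := by fun_prop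
    simpa using this.tendsto t
  apply ArzelaAscoli.isCompact_of_equicontinuous
  · have himage : ContinuousMap.toFun ''
        {g : C(X, E) | (∀ t, g t ∈ B) ∧ ∀ s t, dist (g s) (g t) ≤ |H s - H t|} =
        univ.pi (fun _ => B) ∩ {g : X → E | ∀ s t, dist (g s) (g t) ≤ |H s - H t|} := by
      ext g
      constructor
      · rintro ⟨g, hg, rfl⟩
        exact ⟨fun t _ => hg.1 t, hg.2⟩
      · rintro ⟨hgB, hg⟩
        refine ⟨⟨g, ?_⟩, ⟨fun t => hgB t (mem_univ t), hg⟩, rfl⟩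
        refine continuous_iff_continuousAt.2 fun t => tendsto_iff_dist_tendsto_zero.2 ?_
        exact squeeze_zero (fun _ => dist_nonneg)
          (fun s => (dist_comm _ _).trans_le (hg t s)) (hmod t)
    rw [himage]
    refine (isCompact_univ_pi fun _ => hB).inter_right ?_
    simp only [ofPred_forall]
    exact isClosed_iInter fun s => isClosed_iInter fun t =>
      isClosed_le ((continuous_apply s).dist (continuous_apply t)) continuous_const
  · intro t
    exact Metric.equicontinuousAt_of_continuity_modulus _ (hmod t) _
      (Eventually.of_forall fun s g => g.2.2 t s)

/-- A function on `[a, b]` whose increments are bounded by those of a monotone function keeps this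
property when extended by constants. -/
theorem dist_projIcc_le_of_monotone {E : Type*} [PseudoMetricSpace E] {a b : ℝ} (hab : a ≤ b)
    {H : ℝ → ℝ} (hH : Monotone H) {x : ℝ → E}
    (hx : ∀ s ∈ Icc a b, ∀ t ∈ Icc a b, dist (x s) (x t) ≤ |H s - H t|) (s t : ℝ) :
    dist (x (projIcc a b hab s)) (x (projIcc a b hab t)) ≤ |H s - H t| := by
  refine (hx _ (projIcc a b hab s).2 _ (projIcc a b hab t).2).trans ?_
  simp only [coe_projIcc, hH.map_max, hH.map_min]
  refine (abs_max_sub_max_le_max _ _ _ _).trans (max_le (by simp) ?_)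
  exact (abs_min_sub_min_le_max _ _ _ _).trans (by simp)

theorem stmt_11 (d : ℕ)
    (f : ℝ → EuclideanSpace ℝ (Fin d) → EuclideanSpace ℝ (Fin d))
    -- `f` is an L¹-Carathéodory function:
    (hf_meas : ∀ x, Measurable fun t => f t x)
    (hf_cont : ∀ᵐ t : ℝ ∂volume, Continuous fun x => f t x)
    (hf_dom : ∀ r : ℝ, 0 < r → ∃ h : ℝ → ℝ, LocallyIntegrable h ∧ (∀ t, 0 ≤ h t) ∧
      ∀ᵐ t : ℝ ∂volume, ∀ x : EuclideanSpace ℝ (Fin d), ‖x‖ ≤ r → ‖f t x‖ ≤ h t)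
    (tseq : ℕ → ℝ) (htpos : ∀ n, 0 < tseq n) (htmono : StrictMono tseq)
    (htinf : Tendsto tseq atTop atTop)
    (xseq : ℕ → ℝ → EuclideanSpace ℝ (Fin d))
    -- each `xseq n` is a Carathéodory solution of `x' = f(t,x)` on `[-t_n, t_n]`
    (hsol : ∀ n, ContinuousOn (xseq n) (Icc (-(tseq n)) (tseq n)) ∧
      ∀ t₀ ∈ Icc (-(tseq n)) (tseq n), ∀ t ∈ Icc (-(tseq n)) (tseq n),
        xseq n t = xseq n t₀ + ∫ s in t₀..t, f s (xseq n s))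
    (B : Set (EuclideanSpace ℝ (Fin d))) (hB_closed : IsClosed B)
    (hB_bdd : Bornology.IsBounded B)
    (hxB : ∀ n, ∀ t ∈ Icc (-(tseq n)) (tseq n), xseq n t ∈ B) :
    ∃ φ : ℕ → ℕ, StrictMono φ ∧
      ∃ xt : ℝ → EuclideanSpace ℝ (Fin d),
        Continuous xt ∧
        (∀ t₀ t : ℝ, xt t = xt t₀ + ∫ s in t₀..t, f s (xt s)) ∧
        (∀ t, xt t ∈ B) ∧
        -- uniform convergence on compact subsets of `ℝ` (where the `xseq (φ n)` are defined)
        ∀ K : Set ℝ, IsCompact K → ∀ ε : ℝ, 0 < ε → ∃ N : ℕ, ∀ n ≥ N,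
          K ⊆ Icc (-(tseq (φ n))) (tseq (φ n)) ∧
          ∀ t ∈ K, ‖xseq (φ n) t - xt t‖ < ε := by
  obtain ⟨R, hR, hBR⟩ := hB_bdd.exists_pos_norm_le
  obtain ⟨h, h_loc, h_nonneg, h_bound⟩ := hf_dom R hR
  have h_int (a b : ℝ) : IntervalIntegrable h volume a b :=
    (h_loc.integrableOn_isCompact isCompact_uIcc).intervalIntegrable
  let H : ℝ → ℝ := fun t => ∫ s in (0 : ℝ)..t, h s
  have hH_sub (s t : ℝ) : H t - H s = ∫ u in s..t, h u :=
    intervalIntegral.integral_interval_sub_left (h_int 0 t) (h_int 0 s)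
  have hH_cont : Continuous H := intervalIntegral.continuous_primitive h_int 0
  have hH_mono : Monotone H := fun s t hst => sub_nonneg.1 <| by
    rw [hH_sub]
    exact intervalIntegral.integral_nonneg_of_forall hst h_nonneg
  have ht_le (n : ℕ) : -(tseq n) ≤ tseq n := by linarith [htpos n]
  have hx_dist (n : ℕ) : ∀ s ∈ Icc (-(tseq n)) (tseq n), ∀ t ∈ Icc (-(tseq n)) (tseq n),
      dist (xseq n s) (xseq n t) ≤ |H s - H t| := by
    intro s hs t ht
    rw [dist_eq_norm, (hsol n).2 t ht s hs, add_sub_cancel_left, hH_sub]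
    refine intervalIntegral.norm_integral_le_abs_of_norm_le ?_ (h_int t s)
    rw [ae_restrict_iff' measurableSet_uIoc]
    filter_upwards [h_bound] with u hu hu_mem
    have hu_Icc := uIcc_subset_Icc ht hs (uIoc_subset_uIcc hu_mem)
    exact hu _ (hBR _ (hxB n u hu_Icc))
  let y (n : ℕ) : C(ℝ, EuclideanSpace ℝ (Fin d)) :=
    ⟨fun t => xseq n (projIcc _ _ (ht_le n) t),
      (hsol n).1.domRestrict.comp continuous_projIcc⟩
  have hy_eq (n : ℕ) {t : ℝ} (ht : t ∈ Icc (-(tseq n)) (tseq n)) : y n t = xseq n t :=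
    congrArg (xseq n ∘ Subtype.val) (projIcc_of_mem (ht_le n) ht)
  have hy_B (n : ℕ) (t : ℝ) : y n t ∈ B := hxB n _ (projIcc _ _ (ht_le n) t).2
  obtain ⟨xt, hxt, φ, hφ, hlim⟩ :=
    (isCompact_setOf_dist_le hH_cont (Metric.isCompact_of_isClosed_isBounded hB_closed hB_bdd)
      ).isSeqCompact fun n => ⟨hy_B n, dist_projIcc_le_of_monotone (ht_le n) hH_mono (hx_dist n)⟩
  have h_pointwise (t : ℝ) : Tendsto (fun n => y (φ n) t) atTop (𝓝 (xt t)) :=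
    ((continuous_eval_const t).tendsto xt).comp hlim
  have hφ_inf : Tendsto (fun n => tseq (φ n)) atTop atTop := htinf.comp hφ.tendsto_atTop
  have h_mem (t : ℝ) : ∀ᶠ n in atTop, t ∈ Icc (-(tseq (φ n))) (tseq (φ n)) := by
    filter_upwards [hφ_inf.eventually_ge_atTop |t|] with n hn
    exact abs_le.1 hn
  refine ⟨φ, hφ, xt, xt.continuous, fun t₀ t => ?_, hxt.1, fun K hK ε hε => ?_⟩
  · have h_integral : Tendsto (fun n => ∫ s in t₀..t, f s (y (φ n) s)) atTop
        (𝓝 (∫ s in t₀..t, f s (xt s))) := by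
      refine intervalIntegral.tendsto_integral_filter_of_dominated_convergence h
        (Eventually.of_forall fun n => ?_) (Eventually.of_forall fun n => ?_) (h_int t₀ t) ?_
      · exact (aestronglyMeasurable_caratheodory_comp hf_meas hf_cont
          (y (φ n)).continuous).restrict
      · filter_upwards [h_bound] with s hs _
        exact hs _ (hBR _ (hy_B _ s))
      · filter_upwards [hf_cont] with s hs _
        exact (hs.tendsto _).comp (h_pointwise s)
    refine tendsto_nhds_unique (h_pointwise t) (((h_pointwise t₀).add h_integral).congr' ?_)
    filter_upwards [h_mem t₀, h_mem t] with n ht₀ ht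
    rw [hy_eq _ ht₀, hy_eq _ ht, (hsol (φ n)).2 t₀ ht₀ t ht]
    congr 1
    refine intervalIntegral.integral_congr fun s hs => ?_
    simp only [hy_eq _ (uIcc_subset_Icc ht₀ ht hs)]
  · obtain ⟨M, hM⟩ := hK.isBounded.exists_norm_le
    have h_unif := Metric.tendstoUniformlyOn_iff.1
      (ContinuousMap.tendsto_iff_forall_isCompact_tendstoUniformlyOn.1 hlim K hK) ε hε
    obtain ⟨N, hN⟩ := eventually_atTop.1 (h_unif.and (hφ_inf.eventually_ge_atTop M))
    refine ⟨N, fun n hn => ?_⟩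
    have hK_sub : K ⊆ Icc (-(tseq (φ n))) (tseq (φ n)) := fun t ht =>
      abs_le.1 ((hM t ht).trans (hN n hn).2)
    refine ⟨hK_sub, fun t ht => ?_⟩
    rw [← hy_eq _ (hK_sub ht), ← dist_eq_norm, dist_comm]
    exact (hN n hn).1 t ht
end
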